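/- Consider the d-dimensional nearest-neighbor Kac Hamiltonian on ℝ^Λ, Λ a finite domain in ℤ^d: Φ_Λ(x) = x²/2 − 2 Σ_{i∼j} ln cosh(√(ν/2)(x_i + x_j)), ν > 0, summed over nearest-neighbor pairs. Fix 0 < κ and let ρ : Λ → (0,∞) be any weight with e^{−κ} ≤ ρ(i)/ρ(j) ≤ e^{κ} whenever i ∼ j, and M = diag(ρ(i)). Then for all x ∈ ℝ^Λ and all a ∈ ℝ^Λ, ⟨M⁻¹(Hess Φ_Λ(x))M a, a⟩ ≥ (1 − 2dν(2 + e^{κ})) |a|². In particular, if ν < 1/(2d(2 + e^{κ})), then M⁻¹(Hess Φ_Λ)M ≥ δ₀ for some δ₀ ∈ (0,1), uniformly in Λ and in the weight ρ. -/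

import Mathlib

noncomputable section
open MeasureTheory Real Filter

/-- Partial derivative of `u` in the `i`-th coordinate direction. -/
def pd {Λ : Type*} [Fintype Λ] [DecidableEq Λ] (u : EuclideanSpace ℝ Λ → ℝ)
    (i : Λ) (x : EuclideanSpace ℝ Λ) : ℝ :=
  fderiv ℝ u x (EuclideanSpace.single i 1)

/-- Laplacian of `u` (sum of second partial derivatives). -/
def lap {Λ : Type*} [Fintype Λ] [DecidableEq Λ] (u : EuclideanSpace ℝ Λ → ℝ)
    (x : EuclideanSpace ℝ Λ) : ℝ :=
  ∑ i, pd (pd u i) i x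

/-- Hessian entry `∂_i ∂_j u (x)`. -/
def hess {Λ : Type*} [Fintype Λ] [DecidableEq Λ] (u : EuclideanSpace ℝ Λ → ℝ)
    (x : EuclideanSpace ℝ Λ) (i j : Λ) : ℝ :=
  pd (pd u j) i x

/-- The normalized Gibbs measure `Z⁻¹ e^{-Φ} dx`. -/
def gibbs {Λ : Type*} [Fintype Λ] (Φ : EuclideanSpace ℝ Λ → ℝ) :
    Measure (EuclideanSpace ℝ Λ) :=
  (ENNReal.ofReal (∫ x, Real.exp (-Φ x)))⁻¹ •
    ((volume : Measure (EuclideanSpace ℝ Λ)).withDensity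
      fun x => ENNReal.ofReal (Real.exp (-Φ x)))

/-- The ℓ¹ (lattice) distance between two sites of `ℤ^d`. -/
def latDist {d : ℕ} (i j : Fin d → ℤ) : ℕ := ∑ k, (i k - j k).natAbs

/-- The lattice distance from a site to a finite set of sites. -/
def latDistSet {d : ℕ} (i : Fin d → ℤ) (S : Finset (Fin d → ℤ)) : ℝ :=
  sInf ((fun j => (latDist i j : ℝ)) '' ↑S)

/-- The lattice distance between two finite sets of sites. -/
def latDistSets {d : ℕ} (S T : Finset (Fin d → ℤ)) : ℝ :=
  sInf (Set.image2 (fun i j => (latDist i j : ℝ)) (↑S : Set (Fin d → ℤ)) (↑T : Set (Fin d → ℤ)))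

/-- The d-dimensional nearest-neighbor Kac Hamiltonian
`Φ_Λ(x) = x²/2 − 2 Σ_{i∼j} ln cosh(√(ν/2)(x_i + x_j))`, where the sum is over
(unordered) nearest-neighbor pairs of `Λ`; summing over ordered pairs counts every
unordered pair twice, which accounts for the factor 2. -/
def kacPhi {d : ℕ} (Λ : Finset (Fin d → ℤ)) (ν : ℝ) (x : EuclideanSpace ℝ ↥Λ) : ℝ :=
  ‖x‖ ^ 2 / 2 - ∑ p : ↥Λ × ↥Λ,
    if latDist (↑p.1 : Fin d → ℤ) (↑p.2 : Fin d → ℤ) = 1 then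
      Real.log (Real.cosh (Real.sqrt (ν / 2) * (x p.1 + x p.2)))
    else 0

/-- The functional `x ↦ x i + x j` attached to a pair of sites. -/
def pairSum {ι : Type*} [Fintype ι] (p : ι × ι) : EuclideanSpace ℝ ι →L[ℝ] ℝ :=
  EuclideanSpace.proj p.1 + EuclideanSpace.proj p.2

lemma pairSum_apply {ι : Type*} [Fintype ι] (p : ι × ι) (x : EuclideanSpace ℝ ι) :
    pairSum p x = x p.1 + x p.2 := rfl

lemma hasDerivAt_log_cosh (t : ℝ) :
    HasDerivAt (fun t => Real.log (Real.cosh t)) (Real.sinh t / Real.cosh t) t :=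
  (Real.hasDerivAt_cosh t).log (Real.cosh_pos t).ne'

lemma hasDerivAt_sinh_div_cosh (t : ℝ) :
    HasDerivAt (fun t => Real.sinh t / Real.cosh t) (1 / Real.cosh t ^ 2) t := by
  have h := (Real.hasDerivAt_sinh t).div (Real.hasDerivAt_cosh t) (Real.cosh_pos t).ne'
  refine h.congr_deriv ?_
  rw [← sq, ← sq, Real.cosh_sq_sub_sinh_sq]

lemma pd_kacPhi {d : ℕ} (Λ : Finset (Fin d → ℤ)) (ν : ℝ) (j : ↥Λ) (x : EuclideanSpace ℝ ↥Λ) :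
    pd (kacPhi Λ ν) j x = x j - ∑ p : ↥Λ × ↥Λ,
      if latDist (p.1 : Fin d → ℤ) (p.2 : Fin d → ℤ) = 1 then
        √(ν / 2) * pairSum p (EuclideanSpace.single j 1) *
          (Real.sinh (√(ν / 2) * pairSum p x) / Real.cosh (√(ν / 2) * pairSum p x))
      else 0 := by
  have hnorm : HasFDerivAt (fun x : EuclideanSpace ℝ ↥Λ => ‖x‖ ^ 2 / 2) (innerSL ℝ x) x := by
    have h := (hasStrictFDerivAt_norm_sq x).hasFDerivAt.mul_const (2⁻¹ : ℝ)
    simp only [div_eq_mul_inv]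
    refine h.congr_fderiv ?_
    ext v
    simp
  have hsum : HasFDerivAt (fun x : EuclideanSpace ℝ ↥Λ => ∑ p : ↥Λ × ↥Λ,
      if latDist (p.1 : Fin d → ℤ) (p.2 : Fin d → ℤ) = 1 then
        Real.log (Real.cosh (√(ν / 2) * (x p.1 + x p.2))) else 0)
      (∑ p : ↥Λ × ↥Λ, if latDist (p.1 : Fin d → ℤ) (p.2 : Fin d → ℤ) = 1 then
        (Real.sinh (√(ν / 2) * pairSum p x) / Real.cosh (√(ν / 2) * pairSum p x)) •
          (√(ν / 2) • pairSum p) else 0) x := by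
    refine HasFDerivAt.fun_sum fun p _ => ?_
    split_ifs
    · exact (hasDerivAt_log_cosh _).comp_hasFDerivAt x ((pairSum p).hasFDerivAt.const_mul _)
    · exact hasFDerivAt_const _ _
  have h : fderiv ℝ (kacPhi Λ ν) x = _ := (hnorm.sub hsum).fderiv
  rw [pd, h, sub_apply, sum_apply]
  congr 1
  · simp [EuclideanSpace.inner_single_right]
  · refine Finset.sum_congr rfl fun p _ => ?_
    split_ifs
    · simp only [smul_apply, smul_eq_mul]
      ring
    · rfl

lemma hess_kacPhi {d : ℕ} (Λ : Finset (Fin d → ℤ)) (ν : ℝ) (x : EuclideanSpace ℝ ↥Λ)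
    (i j : ↥Λ) :
    hess (kacPhi Λ ν) x i j = (if i = j then 1 else 0) - ∑ p : ↥Λ × ↥Λ,
      if latDist (p.1 : Fin d → ℤ) (p.2 : Fin d → ℤ) = 1 then
        √(ν / 2) ^ 2 / Real.cosh (√(ν / 2) * pairSum p x) ^ 2 *
          pairSum p (EuclideanSpace.single i 1) * pairSum p (EuclideanSpace.single j 1)
      else 0 := by
  have hproj : HasFDerivAt (fun x : EuclideanSpace ℝ ↥Λ => x j)
      (EuclideanSpace.proj j : EuclideanSpace ℝ ↥Λ →L[ℝ] ℝ) x :=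
    (EuclideanSpace.proj j : EuclideanSpace ℝ ↥Λ →L[ℝ] ℝ).hasFDerivAt
  have hsum : HasFDerivAt (fun x : EuclideanSpace ℝ ↥Λ => ∑ p : ↥Λ × ↥Λ,
      if latDist (p.1 : Fin d → ℤ) (p.2 : Fin d → ℤ) = 1 then
        √(ν / 2) * pairSum p (EuclideanSpace.single j 1) *
          (Real.sinh (√(ν / 2) * pairSum p x) / Real.cosh (√(ν / 2) * pairSum p x))
      else 0)
      (∑ p : ↥Λ × ↥Λ, if latDist (p.1 : Fin d → ℤ) (p.2 : Fin d → ℤ) = 1 then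
        (√(ν / 2) * pairSum p (EuclideanSpace.single j 1)) •
          ((1 / Real.cosh (√(ν / 2) * pairSum p x) ^ 2) • (√(ν / 2) • pairSum p)) else 0) x := by
    refine HasFDerivAt.fun_sum fun p _ => ?_
    split_ifs
    · exact ((hasDerivAt_sinh_div_cosh _).comp_hasFDerivAt x
        ((pairSum p).hasFDerivAt.const_mul _)).const_mul _
    · exact hasFDerivAt_const _ _
  have h := (hproj.sub hsum).fderiv
  rw [hess, funext (pd_kacPhi Λ ν j), pd]
  erw [h]
  rw [sub_apply, sum_apply]
  congr 1
  · simp [eq_comm]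
  · refine Finset.sum_congr rfl fun p _ => ?_
    split_ifs
    · simp only [smul_apply, smul_eq_mul]
      ring
    · rfl

lemma latDist_comm {d : ℕ} (i j : Fin d → ℤ) : latDist i j = latDist j i :=
  Finset.sum_congr rfl fun k _ => by omega

/-- A nearest neighbor differs from a site by a signed unit vector. -/
lemma exists_eq_add_single_of_latDist_eq_one {d : ℕ} {i j : Fin d → ℤ} (h : latDist i j = 1) :
    ∃ k : Fin d, ∃ s ∈ ({1, -1} : Finset ℤ), i + Pi.single k s = j := by
  obtain ⟨k, -, hk⟩ : ∃ k ∈ Finset.univ, (i k - j k).natAbs ≠ 0 := by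
    refine Finset.exists_ne_zero_of_sum_ne_zero (?_ : ∑ k, (i k - j k).natAbs ≠ 0)
    rw [show ∑ k, (i k - j k).natAbs = 1 from h]
    exact one_ne_zero
  have hsplit := Finset.add_sum_erase Finset.univ (fun k => (i k - j k).natAbs) (Finset.mem_univ k)
  rw [show ∑ k, (i k - j k).natAbs = 1 from h] at hsplit
  have hrest : ∑ l ∈ Finset.univ.erase k, (i l - j l).natAbs = 0 := by omega
  refine ⟨k, j k - i k, ?_, ?_⟩
  · simp only [Finset.mem_insert, Finset.mem_singleton]
    omega
  · ext l
    by_cases hl : l = k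
    · subst hl
      simp
    · have := (Finset.sum_eq_zero_iff.mp hrest) l (by simp [hl])
      simp only [Pi.add_apply, Pi.single_eq_of_ne hl]
      omega

lemma card_neighbors_le {d : ℕ} (Λ : Finset (Fin d → ℤ)) (i : Fin d → ℤ) :
    (Finset.univ.filter fun j : ↥Λ => latDist i (j : Fin d → ℤ) = 1).card ≤ 2 * d := by
  have hsub : (Finset.univ.filter fun j : ↥Λ => latDist i (j : Fin d → ℤ) = 1).map
      (Function.Embedding.subtype _) ⊆
      ((Finset.univ : Finset (Fin d)) ×ˢ ({1, -1} : Finset ℤ)).image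
        fun q => i + Pi.single q.1 q.2 := by
    intro j hj
    obtain ⟨j', hj', rfl⟩ := Finset.mem_map.mp hj
    have hadj : latDist i (j' : Fin d → ℤ) = 1 := (Finset.mem_filter.mp hj').2
    obtain ⟨k, s, hs, hks⟩ := exists_eq_add_single_of_latDist_eq_one hadj
    exact Finset.mem_image.mpr ⟨(k, s), Finset.mem_product.mpr ⟨Finset.mem_univ _, hs⟩, hks⟩
  calc _ = _ := (Finset.card_map _).symm
    _ ≤ _ := Finset.card_le_card hsub
    _ ≤ _ := Finset.card_image_le
    _ = 2 * d := by simp [Finset.card_product, mul_comm]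

lemma sum_neighbors_fst_le {d : ℕ} (Λ : Finset (Fin d → ℤ)) (f : ↥Λ → ℝ) (hf : ∀ i, 0 ≤ f i) :
    (∑ p : ↥Λ × ↥Λ, if latDist (p.1 : Fin d → ℤ) (p.2 : Fin d → ℤ) = 1 then f p.1 else 0) ≤
      2 * d * ∑ i, f i := by
  rw [Fintype.sum_prod_type, Finset.mul_sum]
  refine Finset.sum_le_sum fun i _ => ?_
  dsimp only
  rw [← Finset.sum_filter, Finset.sum_const, nsmul_eq_mul]
  exact mul_le_mul_of_nonneg_right (by exact_mod_cast card_neighbors_le Λ i) (hf i)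

lemma sum_neighbors_snd_le {d : ℕ} (Λ : Finset (Fin d → ℤ)) (f : ↥Λ → ℝ) (hf : ∀ i, 0 ≤ f i) :
    (∑ p : ↥Λ × ↥Λ, if latDist (p.1 : Fin d → ℤ) (p.2 : Fin d → ℤ) = 1 then f p.2 else 0) ≤
      2 * d * ∑ i, f i := by
  rw [← Equiv.sum_comp (Equiv.prodComm ↥Λ ↥Λ)]
  simpa only [Equiv.prodComm_apply, Prod.fst_swap, Prod.snd_swap, latDist_comm]
    using sum_neighbors_fst_le Λ f hf

lemma sum_mul_pairSum_single {ι : Type*} [Fintype ι] [DecidableEq ι] (p : ι × ι) (b : ι → ℝ) :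
    ∑ i, b i * pairSum p (EuclideanSpace.single i 1) = b p.1 + b p.2 := by
  simp [pairSum_apply, mul_add, Finset.sum_add_distrib]

/-- The quadratic form of the conjugated Hessian, organized by nearest-neighbor pairs. -/
lemma sum_conj_hess_kacPhi {d : ℕ} (Λ : Finset (Fin d → ℤ)) (ν : ℝ) (ρ : (Fin d → ℤ) → ℝ)
    (hρ : ∀ i, 0 < ρ i) (x : EuclideanSpace ℝ ↥Λ) (a : ↥Λ → ℝ) :
    ∑ i : ↥Λ, ∑ j : ↥Λ, (ρ i)⁻¹ * hess (kacPhi Λ ν) x i j * ρ j * a i * a j =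
      ∑ i, a i ^ 2 - ∑ p : ↥Λ × ↥Λ,
        if latDist (p.1 : Fin d → ℤ) (p.2 : Fin d → ℤ) = 1 then
          √(ν / 2) ^ 2 / Real.cosh (√(ν / 2) * pairSum p x) ^ 2 *
            (((ρ p.1)⁻¹ * a p.1 + (ρ p.2)⁻¹ * a p.2) * (ρ p.1 * a p.1 + ρ p.2 * a p.2))
        else 0 := by
  have hpair (p : ↥Λ × ↥Λ) :
      ((ρ p.1)⁻¹ * a p.1 + (ρ p.2)⁻¹ * a p.2) * (ρ p.1 * a p.1 + ρ p.2 * a p.2) =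
      ∑ i : ↥Λ, ∑ j : ↥Λ, ((ρ i)⁻¹ * a i * pairSum p (EuclideanSpace.single i 1)) *
        (ρ j * a j * pairSum p (EuclideanSpace.single j 1)) := by
    rw [← Finset.sum_mul_sum, sum_mul_pairSum_single p fun i : ↥Λ => (ρ i)⁻¹ * a i,
      sum_mul_pairSum_single p fun i : ↥Λ => ρ i * a i]
  have hdiag : ∑ i, a i ^ 2 =
      ∑ i : ↥Λ, ∑ j : ↥Λ, (ρ i)⁻¹ * (if i = j then 1 else 0) * ρ j * a i * a j := by
    refine Finset.sum_congr rfl fun i _ => ?_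
    have := (hρ i).ne'
    simp only [mul_ite, ite_mul, mul_one, mul_zero, zero_mul, Finset.sum_ite_eq, Finset.mem_univ,
      if_true]
    field_simp
  have hswap (F : ↥Λ × ↥Λ → ↥Λ → ↥Λ → ℝ) :
      ∑ p, ∑ i, ∑ j, F p i j = ∑ i, ∑ j, ∑ p, F p i j := by
    rw [Finset.sum_comm]
    exact Finset.sum_congr rfl fun i _ => Finset.sum_comm
  simp only [hpair, hess_kacPhi, ← Finset.sum_filter, Finset.mul_sum]
  rw [hdiag]
  simp only [Finset.sum_filter]
  have hite (p : ↥Λ × ↥Λ) (F : ↥Λ → ↥Λ → ℝ) :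
      (if latDist (p.1 : Fin d → ℤ) (p.2 : Fin d → ℤ) = 1 then ∑ i, ∑ j, F i j else 0) =
      ∑ i, ∑ j, if latDist (p.1 : Fin d → ℤ) (p.2 : Fin d → ℤ) = 1 then F i j else 0 := by
    split_ifs <;> simp
  simp only [hite]
  rw [hswap]
  simp only [← Finset.sum_sub_distrib]
  refine Finset.sum_congr rfl fun i _ => Finset.sum_congr rfl fun j _ => ?_
  simp only [mul_sub, sub_mul, Finset.mul_sum, Finset.sum_mul]
  congr 1
  refine Finset.sum_congr rfl fun p _ => ?_
  split_ifs <;> ring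

lemma conj_pair_le {r s a b c : ℝ} (hr : 0 < r) (hs : 0 < s) (hrs : r / s ≤ c) (hsr : s / r ≤ c) :
    (r⁻¹ * a + s⁻¹ * b) * (r * a + s * b) ≤ (1 + c) * (a ^ 2 + b ^ 2) := by
  have hexp : (r⁻¹ * a + s⁻¹ * b) * (r * a + s * b) =
      a ^ 2 + b ^ 2 + (r / s + s / r) * (a * b) := by
    field_simp
    ring
  have hpos : 0 < r / s + s / r := by positivity
  rw [hexp]
  nlinarith [mul_nonneg hpos.le (sq_nonneg (a - b)),
    mul_nonneg (by linarith : 0 ≤ 2 * c - (r / s + s / r)) (by positivity : 0 ≤ a ^ 2 + b ^ 2)]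

lemma conj_hess_kacPhi_lower_bound {d : ℕ} {ν κ : ℝ} (hν : 0 < ν) (Λ : Finset (Fin d → ℤ))
    (ρ : (Fin d → ℤ) → ℝ) (hρ : ∀ i, 0 < ρ i)
    (hratio : ∀ i j : Fin d → ℤ, latDist i j = 1 → ρ i / ρ j ≤ Real.exp κ)
    (x : EuclideanSpace ℝ ↥Λ) (a : ↥Λ → ℝ) :
    (1 - 2 * d * ν * (1 + Real.exp κ)) * ∑ i, a i ^ 2 ≤
      ∑ i : ↥Λ, ∑ j : ↥Λ, (ρ i)⁻¹ * hess (kacPhi Λ ν) x i j * ρ j * a i * a j := by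
  rw [sum_conj_hess_kacPhi Λ ν ρ hρ x a]
  have hC : 0 ≤ ν / 2 * (1 + Real.exp κ) := by positivity
  have hterm (p : ↥Λ × ↥Λ) :
      (if latDist (p.1 : Fin d → ℤ) (p.2 : Fin d → ℤ) = 1 then
        √(ν / 2) ^ 2 / Real.cosh (√(ν / 2) * pairSum p x) ^ 2 *
          (((ρ p.1)⁻¹ * a p.1 + (ρ p.2)⁻¹ * a p.2) * (ρ p.1 * a p.1 + ρ p.2 * a p.2))
        else 0) ≤ ν / 2 * (1 + Real.exp κ) *
      ((if latDist (p.1 : Fin d → ℤ) (p.2 : Fin d → ℤ) = 1 then a p.1 ^ 2 else 0) +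
        (if latDist (p.1 : Fin d → ℤ) (p.2 : Fin d → ℤ) = 1 then a p.2 ^ 2 else 0)) := by
    split_ifs with h
    · have hpair := conj_pair_le (a := a p.1) (b := a p.2) (hρ p.1) (hρ p.2) (hratio _ _ h)
        (hratio _ _ (by rwa [latDist_comm]))
      have hw : √(ν / 2) ^ 2 / Real.cosh (√(ν / 2) * pairSum p x) ^ 2 ≤ ν / 2 := by
        rw [Real.sq_sqrt (by positivity)]
        exact div_le_self (by positivity) (one_le_pow₀ (Real.one_le_cosh _))
      calc _ ≤ _ := mul_le_mul_of_nonneg_left hpair (by positivity)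
        _ ≤ _ := mul_le_mul_of_nonneg_right hw (by positivity)
        _ = _ := by ring
    · simp
  have hsum := Finset.sum_le_sum fun p (_ : p ∈ Finset.univ) => hterm p
  rw [← Finset.mul_sum, Finset.sum_add_distrib] at hsum
  have hbound := mul_le_mul_of_nonneg_left
    (add_le_add (sum_neighbors_fst_le Λ (fun i => a i ^ 2) fun i => sq_nonneg _)
      (sum_neighbors_snd_le Λ (fun i => a i ^ 2) fun i => sq_nonneg _)) hC
  linarith

/-- For the Kac Hamiltonian and any weight `ρ` with
`e^{−κ} ≤ ρ(i)/ρ(j) ≤ e^{κ}` for nearest neighbors `i ∼ j`,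
`⟨M⁻¹(Hess Φ_Λ)M a, a⟩ ≥ (1 − 2dν(2 + e^κ))|a|²` for all `x` and `a`; in particular, if
`ν < 1/(2d(2 + e^κ))` then `M⁻¹(Hess Φ_Λ)M ≥ δ₀` for some `δ₀ ∈ (0,1)` uniformly in `Λ`
and in the weight `ρ`. -/
theorem kac_hessian_bound
    (d : ℕ) (hd : 0 < d) (ν κ : ℝ) (hν : 0 < ν) (hκ : 0 < κ) :
    (∀ (Λ : Finset (Fin d → ℤ)) (ρ : (Fin d → ℤ) → ℝ),
      (∀ i, 0 < ρ i) →
      (∀ i j : Fin d → ℤ, latDist i j = 1 →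
        Real.exp (-κ) ≤ ρ i / ρ j ∧ ρ i / ρ j ≤ Real.exp κ) →
      ∀ (x : EuclideanSpace ℝ ↥Λ) (a : ↥Λ → ℝ),
        (1 - 2 * d * ν * (2 + Real.exp κ)) * ∑ i, (a i) ^ 2 ≤
          ∑ i : ↥Λ, ∑ j : ↥Λ, (ρ (↑i : Fin d → ℤ))⁻¹ * hess (kacPhi Λ ν) x i j *
            ρ (↑j : Fin d → ℤ) * a i * a j) ∧
    (ν < 1 / (2 * d * (2 + Real.exp κ)) →
      ∃ δ₀ : ℝ, 0 < δ₀ ∧ δ₀ < 1 ∧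
        ∀ (Λ : Finset (Fin d → ℤ)) (ρ : (Fin d → ℤ) → ℝ),
          (∀ i, 0 < ρ i) →
          (∀ i j : Fin d → ℤ, latDist i j = 1 →
            Real.exp (-κ) ≤ ρ i / ρ j ∧ ρ i / ρ j ≤ Real.exp κ) →
          ∀ (x : EuclideanSpace ℝ ↥Λ) (a : ↥Λ → ℝ),
            δ₀ * ∑ i, (a i) ^ 2 ≤
              ∑ i : ↥Λ, ∑ j : ↥Λ, (ρ (↑i : Fin d → ℤ))⁻¹ * hess (kacPhi Λ ν) x i j *
                ρ (↑j : Fin d → ℤ) * a i * a j) := by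
  have hmain : ∀ (Λ : Finset (Fin d → ℤ)) (ρ : (Fin d → ℤ) → ℝ),
      (∀ i, 0 < ρ i) →
      (∀ i j : Fin d → ℤ, latDist i j = 1 →
        Real.exp (-κ) ≤ ρ i / ρ j ∧ ρ i / ρ j ≤ Real.exp κ) →
      ∀ (x : EuclideanSpace ℝ ↥Λ) (a : ↥Λ → ℝ),
        (1 - 2 * d * ν * (2 + Real.exp κ)) * ∑ i, (a i) ^ 2 ≤
          ∑ i : ↥Λ, ∑ j : ↥Λ, (ρ (↑i : Fin d → ℤ))⁻¹ * hess (kacPhi Λ ν) x i j *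
            ρ (↑j : Fin d → ℤ) * a i * a j := by
    intro Λ ρ hρ hratio x a
    refine le_trans (mul_le_mul_of_nonneg_right ?_ (by positivity))
      (conj_hess_kacPhi_lower_bound hν Λ ρ hρ (fun i j h => (hratio i j h).2) x a)
    have : 0 ≤ 2 * d * ν := by positivity
    linarith
  have hd' : (0 : ℝ) < d := by exact_mod_cast hd
  refine ⟨hmain, fun hsmall => ⟨1 - 2 * d * ν * (2 + Real.exp κ), ?_, ?_, hmain⟩⟩
  · rw [lt_div_iff₀ (by positivity)] at hsmall
    linarith
  · have : 0 < 2 * d * ν * (2 + Real.exp κ) := by positivity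
    linarith
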